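/- Let q be an odd prime power, let (a,b) be a valid pair in F_q^2 with b ∉ {-a, 2-a, a/(2a-1)}, and let N be the number of intercalates of the quadratic quasigroup Q_{a,b}. If (2ab-a-b)(a+b)(a-1) ∈ R_q, 2(a+b-2)(a-1) ∈ N_q and 2a(a+b) ∈ N_q, then N = q(q-1); otherwise N = 0. -/

import Mathlib

open scoped Classical
open Finset

noncomputable section

variable {F : Type*} [Field F] [Fintype F]

/-- `x ∈ R_q`: `x` is a nonzero square in `F`. -/
def inR (x : F) : Prop := x ≠ 0 ∧ IsSquare x

/-- `x ∈ N_q`: `x` is a nonzero non-square in `F`. -/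
def inN (x : F) : Prop := x ≠ 0 ∧ ¬ IsSquare x

/-- `(a, b)` is a valid pair: `ab ∈ R_q` and `(a-1)(b-1) ∈ R_q`. -/
def ValidPair (a b : F) : Prop := inR (a * b) ∧ inR ((a - 1) * (b - 1))

/-- The operation of the quadratic quasigroup `Q_{a,b}`:
`x*y = x + a(y-x)` if `y - x ∈ R_q`, `x*y = x + b(y-x)` if `y - x ∈ N_q`, and `x*x = x`. -/
def qmul (a b x y : F) : F :=
  if inR (y - x) then x + a * (y - x) else x + b * (y - x)


/-- coefficient used by `qmul` -/
def cf (a b u : F) : F := if inR u then a else b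

/-- the other coefficient -/
def cg (a b u : F) : F := if inR u then b else a

lemma qmul_cf (a b x y : F) : qmul a b x y = x + cf a b (y - x) * (y - x) := by
  unfold qmul cf; split_ifs <;> rfl

/-- the generic condition -/
def Cnd (c d : F) : Prop := quadraticChar F ((2 * c * d - c - d) * (c + d) * (c - 1)) = 1 ∧
  quadraticChar F (2 * (c + d - 2) * (c - 1)) = -1 ∧ quadraticChar F (2 * c * (c + d)) = -1

lemma inR_iff (x : F) : inR x ↔ quadraticChar F x = 1 := by
  unfold inR
  constructor
  · rintro ⟨h, h2⟩; exact (quadraticChar_one_iff_isSquare h).2 h2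
  · intro h
    have h0 : x ≠ 0 := by rintro rfl; simp at h
    exact ⟨h0, (quadraticChar_one_iff_isSquare h0).1 h⟩

lemma inN_iff (h2 : ringChar F ≠ 2) (x : F) : inN x ↔ quadraticChar F x = -1 := by
  unfold inN
  rw [quadraticChar_neg_one_iff_not_isSquare]
  constructor
  · exact fun h => h.2
  · intro h
    refine ⟨?_, h⟩
    rintro rfl; exact h (by simp)

lemma chi_cases {x : F} (h : x ≠ 0) : quadraticChar F x = 1 ∨ quadraticChar F x = -1 :=
  quadraticChar_dichotomy h

/-- nondegeneracy of the pair -/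
structure Good (c d : F) : Prop where
  two : (2 : F) ≠ 0
  c0 : c ≠ 0
  d0 : d ≠ 0
  c1 : c - 1 ≠ 0
  d1 : d - 1 ≠ 0
  cd : quadraticChar F c = quadraticChar F d
  cd1 : quadraticChar F (c - 1) = quadraticChar F (d - 1)
  s0 : c + d ≠ 0
  s2 : c + d - 2 ≠ 0
  m : 2 * c * d - c - d ≠ 0

lemma Good.symm {c d : F} (h : Good c d) : Good d c where
  two := h.two
  c0 := h.d0
  d0 := h.c0
  c1 := h.d1
  d1 := h.c1
  cd := h.cd.symm
  cd1 := h.cd1.symm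
  s0 := by rw [add_comm]; exact h.s0
  s2 := by rw [add_comm]; exact h.s2
  m := by intro h'; apply h.m; linear_combination h'

lemma Cnd_symm {c d : F} (h : Good c d) (hc : Cnd c d) : Cnd d c := by
  obtain ⟨h1, h2, h3⟩ := hc
  refine ⟨?_, ?_, ?_⟩
  · rw [show (2 * d * c - d - c) * (d + c) * (d - 1) = (2 * c * d - c - d) * (c + d) * (d - 1) by ring,
      map_mul, ← h.cd1, ← map_mul]; exact h1
  · rw [show d + c - 2 = c + d - 2 by ring, map_mul, ← h.cd1, ← map_mul]; exact h2
  · rw [show 2 * d * (d + c) = 2 * (c + d) * d by ring, map_mul, ← h.cd, ← map_mul, ← h3]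
    congr 1; ring

lemma chi_eq_one {u v : F} (hu : u ≠ 0) (h : quadraticChar F u = quadraticChar F v) :
    quadraticChar F (u * v) = 1 := by
  rw [map_mul, ← h]
  rcases chi_cases hu with h | h <;> simp [h]

lemma eq_of_chi {u v : F} (h : quadraticChar F (u * v) = 1) :
    quadraticChar F u = quadraticChar F v := by
  have h0 : u ≠ 0 := by rintro rfl; simp at h
  have h1 : v ≠ 0 := by rintro rfl; simp at h
  rw [map_mul] at h
  rcases chi_cases h0 with h2 | h2 <;> rcases chi_cases h1 with h3 | h3 <;> simp_all

lemma good_of (hodd : Odd (Fintype.card F)) (a b : F) (hv : ValidPair a b)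
    (hb : b ≠ -a ∧ b ≠ 2 - a ∧ b ≠ a / (2 * a - 1)) : ringChar F ≠ 2 ∧ Good a b := by
  have hr : ringChar F ≠ 2 := by
    intro h
    have := FiniteField.even_card_of_char_two h
    rcases hodd with ⟨k, hk⟩
    omega
  obtain ⟨h1, h2⟩ := hv
  have t1 := (inR_iff _).1 h1
  have t2 := (inR_iff _).1 h2
  have ha := left_ne_zero_of_mul h1.1
  have hb0 := right_ne_zero_of_mul h1.1
  refine ⟨hr, Ring.two_ne_zero hr, ha, hb0, left_ne_zero_of_mul h2.1, right_ne_zero_of_mul h2.1,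
    eq_of_chi t1, eq_of_chi t2, ?_, ?_, ?_⟩
  · intro h; apply hb.1; linear_combination h
  · intro h; apply hb.2.1; linear_combination h
  · intro h
    have h3 : 2 * a - 1 ≠ 0 := by
      intro h4
      apply ha
      linear_combination b * h4 - h
    apply hb.2.2
    rw [eq_div_iff h3]
    linear_combination h

/-- solutions in difference coordinates -/
def Sol (a b w x y z : F) : Prop := w + x = y + z ∧ w ≠ z ∧ w ≠ y ∧
  cf a b w * w - cf a b x * x = w - z ∧ cf a b y * y - cf a b z * z = w - z

/-- `z` is the odd one out -/
def Pat (w x y z : F) : Prop := (inR w ↔ inR x) ∧ (inR w ↔ inR y) ∧ ¬ (inR w ↔ inR z)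

lemma alg_eq {c d w x y z : F} (g : Good c d) (h1 : w + x = y + z) (hz : w ≠ z)
    (h2 : c * w - c * x = w - z) (e : F) (he : e = c ∨ e = d)
    (h3 : e * y - e * z = w - z) : False := by
  have hz' : z = w - c * w + c * x := by linear_combination h2
  have hy' : y = x + c * w - c * x := by linear_combination -h1 - hz'
  subst hz' hy'
  have h4 : (e * (2 * c - 1) - c) * (w - x) = 0 := by linear_combination h3
  rcases mul_eq_zero.1 h4 with h | h
  · rcases he with rfl | rfl
    · have : e * (e - 1) * 2 = 0 := by linear_combination h
      simp [g.c0, g.c1, g.two] at this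
    · apply g.m; linear_combination h
  · apply hz; linear_combination c * h

lemma alg_ne1 {c d w x y z : F} (g : Good c d) (h1 : w + x = y + z)
    (h2 : c * w - d * x = w - z) (h3 : c * y - d * z = w - z) : (c - 1) * w = (d - 1) * x := by
  have hz' : z = w - c * w + d * x := by linear_combination h2
  have hy' : y = x + c * w - d * x := by linear_combination -h1 - hz'
  subst hz' hy'
  apply mul_left_cancel₀ g.s0
  linear_combination h3

lemma alg_ne2 {c d w x y z : F} (g : Good c d) (h1 : w + x = y + z)
    (h2 : c * w - d * x = w - z) (h3 : d * y - c * z = w - z) : c * w = d * x := by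
  have hz' : z = w - c * w + d * x := by linear_combination h2
  have hy' : y = x + c * w - d * x := by linear_combination -h1 - hz'
  subst hz' hy'
  apply mul_left_cancel₀ g.s2
  linear_combination h3

lemma inR_of_eq {u v w x : F} (hv : v ≠ 0) (h : quadraticChar F u = quadraticChar F v)
    (e : u * w = v * x) : inR w ↔ inR x := by
  have := congrArg (quadraticChar F) e
  rw [map_mul, map_mul, h] at this
  have h0 : quadraticChar F v ≠ 0 := by
    rcases chi_cases hv with h | h <;> simp [h]
  rw [inR_iff, inR_iff, mul_left_cancel₀ h0 this]

lemma parity {a b w x y z : F} (g : Good a b) (h : Sol a b w x y z) :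
    ¬ ((inR w ↔ inR x) ↔ (inR y ↔ inR z)) := by
  obtain ⟨h1, hz, hy, h2, h3⟩ := h
  have g' := g.symm
  unfold cf at h2 h3
  intro hp
  by_cases hw : inR w <;> by_cases hx : inR x <;> by_cases hyy : inR y <;>
    by_cases hzz : inR z <;> simp only [hw, hx, hyy, hzz, if_true, if_false] at h2 h3 hp
  all_goals first
    | exact alg_eq g h1 hz h2 _ (Or.inl rfl) h3
    | exact alg_eq g h1 hz h2 _ (Or.inr rfl) h3
    | exact alg_eq g' h1 hz h2 _ (Or.inl rfl) h3
    | exact alg_eq g' h1 hz h2 _ (Or.inr rfl) h3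
    | (have := inR_of_eq g.d1 g.cd1 (alg_ne1 g h1 h2 h3); tauto)
    | (have := inR_of_eq g.d0 g.cd (alg_ne2 g h1 h2 h3); tauto)
    | (have := inR_of_eq g'.d1 g'.cd1 (alg_ne1 g' h1 h2 h3); tauto)
    | (have := inR_of_eq g'.d0 g'.cd (alg_ne2 g' h1 h2 h3); tauto)
    | (exfalso; tauto)

lemma alg_pat {c d w x y z : F} (h1 : w + x = y + z)
    (h2 : c * w - c * x = w - z) (h3 : c * y - d * z = w - z) (hc : c ≠ 0) :
    c * (c + d - 2) * x = (c - 1) * (c + d) * w ∧ (c + d - 2) * z = 2 * (c - 1) * w ∧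
    c * (c + d - 2) * y = (2 * c * d - c - d) * w := by
  have hz' : z = w - c * w + c * x := by linear_combination h2
  have hy' : y = x + c * w - c * x := by linear_combination -h1 - hz'
  subst hz' hy'
  have : c * (c + d - 2) * x = (c - 1) * (c + d) * w := by linear_combination -h3
  refine ⟨this, ?_, ?_⟩
  · linear_combination this
  · linear_combination (1 - c) * this

lemma pat_coef {a b w x y z : F} (hp : Pat w x y z) :
    cf a b x = cf a b w ∧ cf a b y = cf a b w ∧ cf a b z = cg a b w := by
  unfold Pat at hp
  unfold cf cg
  by_cases hw : inR w <;> simp only [hw, true_iff, false_iff, not_not] at hp <;> simp [hw, hp]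

lemma good_cf {a b : F} (g : Good a b) (w : F) : Good (cf a b w) (cg a b w) := by
  unfold cf cg; split_ifs
  · exact g
  · exact g.symm

lemma Cnd_cf {a b : F} (g : Good a b) (w : F) : Cnd (cf a b w) (cg a b w) ↔ Cnd a b := by
  unfold cf cg; split_ifs
  · rfl
  · exact ⟨Cnd_symm g.symm, Cnd_symm g⟩

lemma sol_pat {a b w x y z : F} (g : Good a b) (h : Sol a b w x y z) (hp : Pat w x y z) :
    let c := cf a b w
    let d := cg a b w
    c * (c + d - 2) * x = (c - 1) * (c + d) * w ∧ (c + d - 2) * z = 2 * (c - 1) * w ∧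
    c * (c + d - 2) * y = (2 * c * d - c - d) * w := by
  intro c d
  obtain ⟨h1, hz, hy, h2, h3⟩ := h
  obtain ⟨e1, e2, e3⟩ := pat_coef (a := a) (b := b) hp
  rw [e1] at h2
  rw [e2, e3] at h3
  exact alg_pat h1 h2 h3 (good_cf g w).c0

lemma chi_inv {c d w x y z : F} (g : Good c d) (hw : w ≠ 0)
    (h1 : c * (c + d - 2) * x = (c - 1) * (c + d) * w) (h2 : (c + d - 2) * z = 2 * (c - 1) * w)
    (h3 : c * (c + d - 2) * y = (2 * c * d - c - d) * w) :
    x ≠ 0 ∧ y ≠ 0 ∧ z ≠ 0 ∧ (Cnd c d ↔ quadraticChar F x = quadraticChar F w ∧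
      quadraticChar F y = quadraticChar F w ∧ quadraticChar F z = - quadraticChar F w) := by
  have hx0 : x ≠ 0 := by
    rintro rfl
    rw [mul_zero] at h1
    exact mul_ne_zero (mul_ne_zero g.c1 g.s0) hw h1.symm
  have hz0 : z ≠ 0 := by
    rintro rfl
    rw [mul_zero] at h2
    exact mul_ne_zero (mul_ne_zero g.two g.c1) hw h2.symm
  have hy0 : y ≠ 0 := by
    rintro rfl
    rw [mul_zero] at h3
    exact mul_ne_zero g.m hw h3.symm
  refine ⟨hx0, hy0, hz0, ?_⟩
  have k1 := congrArg (quadraticChar F) h1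
  have k2 := congrArg (quadraticChar F) h2
  have k3 := congrArg (quadraticChar F) h3
  unfold Cnd
  simp only [map_mul] at k1 k2 k3 ⊢
  have := chi_cases g.c0
  have := chi_cases g.c1
  have := chi_cases g.s0
  have := chi_cases g.s2
  have := chi_cases g.two
  have := chi_cases g.m
  have := chi_cases hw
  have := chi_cases hx0
  have := chi_cases hy0
  have := chi_cases hz0
  generalize quadraticChar F c = C at *
  generalize quadraticChar F (c - 1) = C1 at *
  generalize quadraticChar F (c + d) = S at *
  generalize quadraticChar F (c + d - 2) = S2 at *
  generalize quadraticChar F 2 = T at *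
  generalize quadraticChar F (2 * c * d - c - d) = M at *
  generalize quadraticChar F w = W at *
  generalize quadraticChar F x = X at *
  generalize quadraticChar F y = Y at *
  generalize quadraticChar F z = Z at *
  clear h1 h2 h3 hx0 hy0 hz0 hw g
  have hX : X = C * S2 * (C1 * S * W) := by
    rw [← k1]; rcases ‹C = 1 ∨ C = -1› with rfl | rfl <;> rcases ‹S2 = 1 ∨ S2 = -1› with rfl | rfl <;> ring
  have hZ : Z = S2 * (T * C1 * W) := by
    rw [← k2]; rcases ‹S2 = 1 ∨ S2 = -1› with rfl | rfl <;> ring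
  have hY : Y = C * S2 * (M * W) := by
    rw [← k3]; rcases ‹C = 1 ∨ C = -1› with rfl | rfl <;> rcases ‹S2 = 1 ∨ S2 = -1› with rfl | rfl <;> ring
  clear k1 k2 k3
  subst hX hY hZ
  rcases ‹C = 1 ∨ C = -1› with rfl | rfl <;> rcases ‹S2 = 1 ∨ S2 = -1› with rfl | rfl <;>
  rcases ‹C1 = 1 ∨ C1 = -1› with rfl | rfl <;> rcases ‹S = 1 ∨ S = -1› with rfl | rfl <;>
  rcases ‹T = 1 ∨ T = -1› with rfl | rfl <;> rcases ‹M = 1 ∨ M = -1› with rfl | rfl <;>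
  rcases ‹W = 1 ∨ W = -1› with rfl | rfl <;> simp

lemma pat_iff {w x y z : F} (hw : w ≠ 0) (hx : x ≠ 0) (hy : y ≠ 0) (hz : z ≠ 0) :
    Pat w x y z ↔ quadraticChar F x = quadraticChar F w ∧
      quadraticChar F y = quadraticChar F w ∧ quadraticChar F z = - quadraticChar F w := by
  unfold Pat
  simp only [inR_iff]
  rcases chi_cases hw with h | h <;> rcases chi_cases hx with h' | h' <;>
  rcases chi_cases hy with h'' | h'' <;> rcases chi_cases hz with h3 | h3 <;> simp [h, h', h'', h3]

lemma sol_w {a b w x y z : F} (g : Good a b) (h : Sol a b w x y z) (hp : Pat w x y z) : w ≠ 0 := by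
  obtain ⟨-, h2, -⟩ := sol_pat g h hp
  rintro rfl
  apply h.2.1
  rw [mul_zero] at h2
  exact ((mul_eq_zero.1 h2).resolve_left (good_cf g _).s2).symm

lemma sol_cnd {a b w x y z : F} (g : Good a b) (h : Sol a b w x y z) (hp : Pat w x y z) :
    Cnd a b := by
  have hw := sol_w g h hp
  obtain ⟨h1, h2, h3⟩ := sol_pat g h hp
  obtain ⟨hx, hy, hz, hc⟩ := chi_inv (good_cf g w) hw h1 h2 h3
  rw [← Cnd_cf g w, hc, ← pat_iff hw hx hy hz]
  exact hp

lemma sol_exists {a b w : F} (g : Good a b) (hc : Cnd a b) (hw : w ≠ 0) :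
    ∃ x y z, Sol a b w x y z ∧ Pat w x y z := by
  have G := good_cf g w
  have hc' := (Cnd_cf g w).2 hc
  set c := cf a b w with hcd
  set d := cg a b w with hdd
  have n1 := G.c0
  have n2 := G.s2
  have h1 : c * (c + d - 2) * ((c - 1) * (c + d) * w / (c * (c + d - 2))) =
    (c - 1) * (c + d) * w := by field_simp
  have h2 : (c + d - 2) * (2 * (c - 1) * w / (c + d - 2)) = 2 * (c - 1) * w := by field_simp
  have h3 : c * (c + d - 2) * ((2 * c * d - c - d) * w / (c * (c + d - 2))) =
    (2 * c * d - c - d) * w := by field_simp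
  generalize (c - 1) * (c + d) * w / (c * (c + d - 2)) = x at h1
  generalize 2 * (c - 1) * w / (c + d - 2) = z at h2
  generalize (2 * c * d - c - d) * w / (c * (c + d - 2)) = y at h3
  obtain ⟨hx, hy, hz, hcc⟩ := chi_inv G hw h1 h2 h3
  have hp : Pat w x y z := by rw [pat_iff hw hx hy hz, ← hcc]; exact hc'
  obtain ⟨e1, e2, e3⟩ := pat_coef (a := a) (b := b) hp
  have n12 := mul_ne_zero n1 n2
  have q1 : w + x = y + z := by
    apply mul_left_cancel₀ n12
    linear_combination h1 - h3 - c * h2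
  have q2 : c * w - c * x = w - z := by
    apply mul_left_cancel₀ n12
    linear_combination -c * h1 + c * h2
  have q3 : c * y - d * z = w - z := by
    apply mul_left_cancel₀ n12
    linear_combination c * h3 + c * (1 - d) * h2
  refine ⟨x, y, z, ⟨q1, ?_, ?_, ?_, ?_⟩, hp⟩
  · rintro rfl; exact hp.2.2 Iff.rfl
  · rintro rfl
    have : 2 * (c - 1) * (c * w) = 0 := by
      have : x = z := by linear_combination q1
      subst this
      have q4 : (c - 1) * (w - x) = 0 := by linear_combination q2
      have : w - x = 0 := (mul_eq_zero.1 q4).resolve_left G.c1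
      have : w = x := by linear_combination this
      subst this
      exact absurd Iff.rfl hp.2.2
    simp [G.two, G.c1, G.c0, hw] at this
  · rw [e1]; exact q2
  · rw [e2, e3]; exact q3

lemma sol_unique {a b w x y z x' y' z' : F} (g : Good a b) (h : Sol a b w x y z)
    (hp : Pat w x y z) (h' : Sol a b w x' y' z') (hp' : Pat w x' y' z') : y = y' ∧ z = z' := by
  obtain ⟨-, h2, h3⟩ := sol_pat g h hp
  obtain ⟨-, k2, k3⟩ := sol_pat g h' hp'
  have G := good_cf g w
  exact ⟨mul_left_cancel₀ (mul_ne_zero G.c0 G.s2) (h3.trans k3.symm),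
    mul_left_cancel₀ G.s2 (h2.trans k2.symm)⟩

/-- the set of ordered intercalates -/
def SS (a b : F) : Finset (F × F × F × F) := Finset.univ.filter fun t : F × F × F × F =>
        t.1 ≠ t.2.1 ∧ t.2.2.1 ≠ t.2.2.2 ∧
        qmul a b t.1 t.2.2.1 = qmul a b t.2.1 t.2.2.2 ∧
        qmul a b t.1 t.2.2.2 = qmul a b t.2.1 t.2.2.1

lemma mem_SS (a b r s c d : F) : (r, s, c, d) ∈ SS a b ↔ r ≠ s ∧ c ≠ d ∧
    qmul a b r c = qmul a b s d ∧ qmul a b r d = qmul a b s c := by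
  simp [SS]

lemma mem_SS_sol (a b r s c d : F) : (r, s, c, d) ∈ SS a b ↔
    Sol a b (c - r) (d - s) (d - r) (c - s) := by
  rw [mem_SS]
  simp only [qmul_cf, Sol]
  constructor
  · rintro ⟨h1, h2, h3, h4⟩
    refine ⟨by ring, fun h => h1 (by linear_combination -h), fun h => h2 (by linear_combination h),
      by linear_combination h3, by linear_combination h4⟩
  · rintro ⟨-, h1, h2, h3, h4⟩
    refine ⟨fun h => h1 (by rw [h]), fun h => h2 (by rw [h]),
      by linear_combination h3, by linear_combination h4⟩

/-- pattern on quadruples -/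
def P (t : F × F × F × F) : Prop :=
  Pat (t.2.2.1 - t.1) (t.2.2.2 - t.2.1) (t.2.2.2 - t.1) (t.2.2.1 - t.2.1)

/-- swap rows -/
def rho (t : F × F × F × F) : F × F × F × F := (t.2.1, t.1, t.2.2.1, t.2.2.2)

/-- swap columns -/
def sig (t : F × F × F × F) : F × F × F × F := (t.1, t.2.1, t.2.2.2, t.2.2.1)

lemma rho_mem {a b : F} {t : F × F × F × F} (h : t ∈ SS a b) : rho t ∈ SS a b := by
  obtain ⟨r, s, c, d⟩ := t
  rw [mem_SS] at h
  rw [rho, mem_SS]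
  exact ⟨h.1.symm, h.2.1, h.2.2.2.symm, h.2.2.1.symm⟩

lemma sig_mem {a b : F} {t : F × F × F × F} (h : t ∈ SS a b) : sig t ∈ SS a b := by
  obtain ⟨r, s, c, d⟩ := t
  rw [mem_SS] at h
  rw [sig, mem_SS]
  exact ⟨h.1, h.2.1.symm, h.2.2.2, h.2.2.1⟩

lemma card_fib (a b : F) (f : F × F × F × F → F × F × F × F)
    (hf : ∀ t ∈ SS a b, f t ∈ SS a b) (hff : ∀ t, f (f t) = t) :
    ((SS a b).filter fun t => P (f t)).card = ((SS a b).filter P).card := by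
  apply Finset.card_bij' (fun t _ => f t) (fun t _ => f t)
  · intro t ht
    rw [Finset.mem_filter] at ht ⊢
    exact ⟨hf _ ht.1, ht.2⟩
  · intro t ht
    rw [Finset.mem_filter] at ht ⊢
    exact ⟨hf _ ht.1, by rw [hff]; exact ht.2⟩
  · intro t _; exact hff t
  · intro t _; exact hff t

lemma card_SS {a b : F} (g : Good a b) : (SS a b).card = 4 * ((SS a b).filter P).card := by
  have h1 := card_fib a b rho (fun _ => rho_mem) (fun _ => rfl)
  have h2 := card_fib a b sig (fun _ => sig_mem) (fun _ => rfl)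
  have h3 := card_fib a b (fun t => rho (sig t)) (fun _ h => rho_mem (sig_mem h)) (fun _ => rfl)
  have key : (SS a b).card = ((SS a b).filter P).card + ((SS a b).filter fun t => P (rho t)).card
      + ((SS a b).filter fun t => P (sig t)).card
      + ((SS a b).filter fun t => P (rho (sig t))).card := by
    rw [Finset.card_eq_sum_ones]
    simp only [Finset.card_filter]
    rw [← Finset.sum_add_distrib, ← Finset.sum_add_distrib, ← Finset.sum_add_distrib]
    apply Finset.sum_congr rfl
    rintro ⟨r, s, c, d⟩ ht
    have := parity g ((mem_SS_sol _ _ _ _ _ _).1 ht)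
    simp only [P, rho, sig, Pat]
    by_cases hw : inR (c - r) <;> by_cases hx : inR (d - s) <;> by_cases hy : inR (d - r) <;>
      by_cases hz : inR (c - s) <;> simp [hw, hx, hy, hz] at this ⊢
  rw [key, h1, h2, h3]; ring

lemma card_P {a b : F} (g : Good a b) (hc : Cnd a b) :
    ((SS a b).filter P).card = Fintype.card F * (Fintype.card F - 1) := by
  have : (Finset.univ : Finset F).offDiag.card = Fintype.card F * (Fintype.card F - 1) := by
    rw [Finset.offDiag_card, Finset.card_univ, Nat.mul_sub, mul_one]
  rw [← this]
  apply Finset.card_bij (fun t _ => (t.1, t.2.2.1))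
  · rintro ⟨r, s, c, d⟩ ht
    rw [Finset.mem_filter, mem_SS_sol] at ht
    have := sol_w g ht.1 ht.2
    simp only [Finset.mem_offDiag, Finset.mem_univ, true_and]
    rintro rfl
    exact this (sub_self _)
  · rintro ⟨r, s, c, d⟩ ht ⟨r', s', c', d'⟩ ht' h
    rw [Finset.mem_filter, mem_SS_sol] at ht ht'
    simp only [Prod.mk.injEq] at h
    obtain ⟨rfl, rfl⟩ := h
    obtain ⟨h1, h2⟩ := sol_unique g ht.1 ht.2 ht'.1 ht'.2
    rw [sub_left_inj] at h1
    rw [sub_right_inj] at h2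
    rw [h1, h2]
  · rintro ⟨r, c⟩ h
    simp only [Finset.mem_offDiag, Finset.mem_univ, true_and] at h
    obtain ⟨x, y, z, hs, hp⟩ := sol_exists g hc (sub_ne_zero.2 h.symm)
    have e1 : y + r - r = y := by ring
    have e2 : c - (c - z) = z := by ring
    have e3 : y + r - (c - z) = x := by linear_combination -hs.1
    refine ⟨(r, c - z, c, y + r), ?_, rfl⟩
    rw [Finset.mem_filter, mem_SS_sol]
    simp only [P, e1, e2, e3]
    exact ⟨hs, hp⟩

/-- For a valid pair `(a,b)` with `b ∉ {-a, 2-a, a/(2a-1)}`, the number `N` of intercalates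
of `Q_{a,b}` (a quarter of the number of quadruples `(r₁,r₂,c₁,c₂)` with `r₁ ≠ r₂`,
`c₁ ≠ c₂`, `r₁*c₁ = r₂*c₂` and `r₁*c₂ = r₂*c₁`) equals `q(q-1)` if
`(2ab-a-b)(a+b)(a-1) ∈ R_q`, `2(a+b-2)(a-1) ∈ N_q` and `2a(a+b) ∈ N_q`,
and equals `0` otherwise. -/
theorem intercalate_count_generic
    (hodd : Odd (Fintype.card F)) (a b : F) (hv : ValidPair a b)
    (hb : b ≠ -a ∧ b ≠ 2 - a ∧ b ≠ a / (2 * a - 1))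
    (N : ℕ)
    (hN : 4 * N = (Finset.univ.filter fun t : F × F × F × F =>
        t.1 ≠ t.2.1 ∧ t.2.2.1 ≠ t.2.2.2 ∧
        qmul a b t.1 t.2.2.1 = qmul a b t.2.1 t.2.2.2 ∧
        qmul a b t.1 t.2.2.2 = qmul a b t.2.1 t.2.2.1).card) :
    ((inR ((2 * a * b - a - b) * (a + b) * (a - 1)) ∧
        inN (2 * (a + b - 2) * (a - 1)) ∧ inN (2 * a * (a + b))) →
      N = Fintype.card F * (Fintype.card F - 1)) ∧
    (¬ (inR ((2 * a * b - a - b) * (a + b) * (a - 1)) ∧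
        inN (2 * (a + b - 2) * (a - 1)) ∧ inN (2 * a * (a + b))) →
      N = 0) := by
  obtain ⟨hr, g⟩ := good_of hodd a b hv hb
  have hN' : 4 * N = 4 * ((SS a b).filter P).card := by rw [hN, ← card_SS g]; rfl
  have hN2 : N = ((SS a b).filter P).card := by omega
  rw [inR_iff, inN_iff hr, inN_iff hr]
  refine ⟨fun h => ?_, fun h => ?_⟩
  · rw [hN2]; exact card_P g h
  · rw [hN2, Finset.card_eq_zero, Finset.filter_eq_empty_iff]
    rintro ⟨r, s, c, d⟩ ht hp
    exact h (sol_cnd g ((mem_SS_sol _ _ _ _ _ _).1 ht) hp)
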